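/- arXiv:2509.14426 — 4 statements merged into one kernel-verified Lean document; each statement's English description precedes it below -/
import Mathlib

section
/- Let x̄ ∈ ℝ^n. If x̄ is a local weakly ≼ˡ_K-minimal point of the set optimization problem of minimizing F with respect to ≼ˡ_K, i.e., there exists δ > 0 such that no x with ‖x − x̄‖ < δ satisfies F(x) ≺ˡ_K F(x̄), then x̄ is a K-critical point for F. -/
open Set Metric Pointwise

noncomputable section

/-- Oriented distance function `Δ_A(y) = d(y, A) − d(y, Aᶜ)`. -/
def orientedDist {E : Type*} [NormedAddCommGroup E] (A : Set E) (y : E) : ℝ :=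
  Metric.infDist y A - Metric.infDist y Aᶜ

/-- The vector `sᵀ∇²f(x)s` of second-order directional derivatives. -/
def quadForm {E F : Type*} [NormedAddCommGroup E] [NormedSpace ℝ E]
    [NormedAddCommGroup F] [NormedSpace ℝ F] (f : E → F) (x s : E) : F :=
  fderiv ℝ (fun y => fderiv ℝ f y s) x s

/-- Quadratic model `m(s) = ∇f(x)ᵀs + ½ sᵀ∇²f(x)s`. -/
def modelFn {E F : Type*} [NormedAddCommGroup E] [NormedSpace ℝ E]
    [NormedAddCommGroup F] [NormedSpace ℝ F] (f : E → F) (x s : E) : F :=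
  fderiv ℝ f x s + (2⁻¹ : ℝ) • quadForm f x s

variable {n m p : ℕ}

/-- The set of `K`-minimal elements of `A`: `{y ∈ A : (y − K) ∩ A = {y}}`. -/
def MinSet (K A : Set (EuclideanSpace ℝ (Fin m))) : Set (EuclideanSpace ℝ (Fin m)) :=
  {y | y ∈ A ∧ {z | y - z ∈ K} ∩ A = {y}}

/-- The set of weakly `K`-minimal elements of `A`: `{y ∈ A : (y − int K) ∩ A = ∅}`. -/
def WMinSet (K A : Set (EuclideanSpace ℝ (Fin m))) : Set (EuclideanSpace ℝ (Fin m)) :=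
  {y | y ∈ A ∧ {z | y - z ∈ interior K} ∩ A = ∅}

/-- The set-valued objective `F(x) = {f¹(x), …, fᵖ(x)}`. -/
def Fval (f : Fin p → EuclideanSpace ℝ (Fin n) → EuclideanSpace ℝ (Fin m))
    (x : EuclideanSpace ℝ (Fin n)) : Set (EuclideanSpace ℝ (Fin m)) :=
  Set.range fun i => f i x

/-- `a` is an element of the partition set `P_xb`: to each `v ∈ WMin(F(xb), K)` it
assigns an index `a v` with `f^{a v}(xb) = v` and `v ∈ Min(F(xb), K)`. -/
def IsSelection (K : Set (EuclideanSpace ℝ (Fin m)))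
    (f : Fin p → EuclideanSpace ℝ (Fin n) → EuclideanSpace ℝ (Fin m))
    (xb : EuclideanSpace ℝ (Fin n)) (a : EuclideanSpace ℝ (Fin m) → Fin p) : Prop :=
  ∀ v ∈ WMinSet K (Fval f xb), f (a v) xb = v ∧ v ∈ MinSet K (Fval f xb)

/-- `xb` is a `K`-critical point for `F`. -/
def KCritical (K : Set (EuclideanSpace ℝ (Fin m)))
    (f : Fin p → EuclideanSpace ℝ (Fin n) → EuclideanSpace ℝ (Fin m))
    (xb : EuclideanSpace ℝ (Fin n)) : Prop :=
  ¬ ∃ (a : EuclideanSpace ℝ (Fin m) → Fin p) (s : EuclideanSpace ℝ (Fin n)),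
      IsSelection K f xb a ∧
      ∀ v ∈ WMinSet K (Fval f xb), fderiv ℝ (f (a v)) xb s ∈ -interior K

/-- Strict lower set less relation: `A ≺ˡ_K B ⟺ B ⊆ A + int K`. -/
def StrictLowerLess (K A B : Set (EuclideanSpace ℝ (Fin m))) : Prop :=
  B ⊆ A + interior K

/-- The value `Θ_xb(a, s)`: max over `v ∈ WMin(F(xb), K)` of
`max{Δ_{−K}(∇f^{a v}(xb)ᵀs + ½ sᵀ∇²f^{a v}(xb)s), Δ_{−K}(∇f^{a v}(xb)ᵀs)}`. -/
def Theta (K : Set (EuclideanSpace ℝ (Fin m)))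
    (f : Fin p → EuclideanSpace ℝ (Fin n) → EuclideanSpace ℝ (Fin m))
    (xb : EuclideanSpace ℝ (Fin n)) (a : EuclideanSpace ℝ (Fin m) → Fin p)
    (s : EuclideanSpace ℝ (Fin n)) : ℝ :=
  sSup {r : ℝ | ∃ v ∈ WMinSet K (Fval f xb), r =
      max (orientedDist (-K) (modelFn (f (a v)) xb s))
          (orientedDist (-K) (fderiv ℝ (f (a v)) xb s))}

/-- `(a, s)` attains the minimum defining `θ(xb)` over `P_xb × {s : ‖s‖ ≤ Ω}`. -/
def AttainsMin (K : Set (EuclideanSpace ℝ (Fin m)))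
    (f : Fin p → EuclideanSpace ℝ (Fin n) → EuclideanSpace ℝ (Fin m))
    (xb : EuclideanSpace ℝ (Fin n)) (Ω : ℝ)
    (a : EuclideanSpace ℝ (Fin m) → Fin p) (s : EuclideanSpace ℝ (Fin n)) : Prop :=
  IsSelection K f xb a ∧ ‖s‖ ≤ Ω ∧
    ∀ (a' : EuclideanSpace ℝ (Fin m) → Fin p) (s' : EuclideanSpace ℝ (Fin n)),
      IsSelection K f xb a' → ‖s'‖ ≤ Ω → Theta K f xb a s ≤ Theta K f xb a' s'

section Cone

variable {E : Type*} [NormedAddCommGroup E] [NormedSpace ℝ E] {K : Set E}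

theorem add_mem_of_convex_of_cone (hK : Convex ℝ K)
    (hcone : ∀ t : ℝ, 0 ≤ t → ∀ y ∈ K, t • y ∈ K) {a b : E} (ha : a ∈ K) (hb : b ∈ K) :
    a + b ∈ K := by
  have h : (2⁻¹ : ℝ) • a + (2⁻¹ : ℝ) • b ∈ K :=
    hK ha hb (by norm_num) (by norm_num) (by norm_num)
  simpa [← smul_add, smul_smul] using hcone 2 (by norm_num) _ h

theorem add_mem_interior_of_convex_of_cone (hK : Convex ℝ K)
    (hcone : ∀ t : ℝ, 0 ≤ t → ∀ y ∈ K, t • y ∈ K) {a b : E}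
    (ha : a ∈ interior K) (hb : b ∈ K) : a + b ∈ interior K := by
  have hsub : K + K ⊆ K := by
    rintro _ ⟨x, hx, y, hy, rfl⟩
    exact add_mem_of_convex_of_cone hK hcone hx hy
  exact interior_mono hsub (subset_interior_add_left (Set.add_mem_add ha hb))

theorem smul_mem_interior_of_cone (hcone : ∀ t : ℝ, 0 ≤ t → ∀ y ∈ K, t • y ∈ K)
    {t : ℝ} (ht : 0 < t) {y : E} (hy : y ∈ interior K) : t • y ∈ interior K := by
  have hsub : t • K ⊆ K := by
    rintro _ ⟨x, hx, rfl⟩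
    exact hcone t ht.le x hx
  apply interior_mono hsub
  rw [interior_smul₀ ht.ne']
  exact Set.smul_mem_smul_set hy

/-- A direction whose derivative lies in `-int K` is a strict `K`-descent direction. -/
theorem eventually_sub_mem_interior_of_fderiv {G : Type*} [NormedAddCommGroup G]
    [NormedSpace ℝ G] (hcone : ∀ t : ℝ, 0 ≤ t → ∀ y ∈ K, t • y ∈ K) {g : G → E} {x s : G}
    (hg : DifferentiableAt ℝ g x) (hs : fderiv ℝ g x s ∈ -interior K) :
    ∀ᶠ t : ℝ in nhdsWithin 0 (Set.Ioi 0), g x - g (x + t • s) ∈ interior K := by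
  have hlim := (hg.hasFDerivAt.hasLineDerivAt s).tendsto_slope_zero_right
  have hopen : IsOpen (-interior K) := isOpen_interior.neg
  filter_upwards [hlim.eventually (hopen.mem_nhds hs), self_mem_nhdsWithin] with t h ht
  have ht : 0 < t := ht
  have h' := smul_mem_interior_of_cone hcone ht (Set.mem_neg.1 h)
  simpa [smul_smul, mul_inv_cancel₀ ht.ne'] using h'

end Cone

/-- Every element of a finite set is `K`-dominated by a weakly minimal one. -/
theorem exists_mem_WMinSet_sub_mem {m : ℕ} {K A : Set (EuclideanSpace ℝ (Fin m))}
    (hK : Convex ℝ K) (hcone : ∀ t : ℝ, 0 ≤ t → ∀ y ∈ K, t • y ∈ K)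
    (h0 : (0 : EuclideanSpace ℝ (Fin m)) ∉ interior K) (h0' : 0 ∈ K) (hA : A.Finite)
    {y : EuclideanSpace ℝ (Fin m)} (hy : y ∈ A) : ∃ w ∈ WMinSet K A, y - w ∈ K := by
  let r : EuclideanSpace ℝ (Fin m) → EuclideanSpace ℝ (Fin m) → Prop :=
    fun z w => w - z ∈ interior K
  have : IsStrictOrder _ r :=
    { irrefl := fun z hz => h0 (by simpa [r] using hz)
      trans := fun a b c hab hbc => by
        simpa [r] using
          add_mem_interior_of_convex_of_cone hK hcone hbc (interior_subset hab) }
  have hfin : {z ∈ A | y - z ∈ K}.Finite := hA.subset (Set.sep_subset _ _)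
  obtain ⟨⟨w, hwA, hyw⟩, -, hmin⟩ := (hfin.wellFoundedOn (r := r)).has_min Set.univ
    ⟨⟨y, hy, by simpa using h0'⟩, Set.mem_univ _⟩
  refine ⟨w, ⟨hwA, Set.eq_empty_of_forall_notMem ?_⟩, hyw⟩
  rintro z ⟨hz, hzA⟩
  refine hmin ⟨z, hzA, ?_⟩ (Set.mem_univ _) hz
  simpa using add_mem_of_convex_of_cone hK hcone hyw (interior_subset hz)

/-- a local weakly `≼ˡ_K`-minimal point of the set optimization problem
is a `K`-critical point for `F`. -/
theorem localWeaklyMinimal_isKCritical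
    {n m p : ℕ} (K : Set (EuclideanSpace ℝ (Fin m)))
    (hKne : K.Nonempty) (hKclosed : IsClosed K) (hKconvex : Convex ℝ K)
    (hKcone : ∀ t : ℝ, 0 ≤ t → ∀ y ∈ K, t • y ∈ K)
    (hKpointed : K ∩ -K = {0})
    (hKsolid : (interior K).Nonempty)
    (f : Fin p → EuclideanSpace ℝ (Fin n) → EuclideanSpace ℝ (Fin m))
    (hf : ∀ i, ContDiff ℝ 2 (f i))
    (xb : EuclideanSpace ℝ (Fin n))
    (hloc : ∃ δ > (0 : ℝ), ∀ x : EuclideanSpace ℝ (Fin n),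
        ‖x - xb‖ < δ → ¬ StrictLowerLess K (Fval f x) (Fval f xb)) :
    KCritical K f xb := by
  rintro ⟨a, s, ha, hs⟩
  obtain ⟨δ, hδ, hloc⟩ := hloc
  by_cases h0 : (0 : EuclideanSpace ℝ (Fin m)) ∈ interior K
  · refine hloc xb (by simpa using hδ) ?_
    rintro _ ⟨i, rfl⟩
    exact ⟨f i xb, ⟨i, rfl⟩, 0, h0, add_zero _⟩
  have h0K : (0 : EuclideanSpace ℝ (Fin m)) ∈ K :=
    (hKpointed.symm ▸ Set.mem_singleton 0 : (0 : EuclideanSpace ℝ (Fin m)) ∈ K ∩ -K).1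
  have hfin : (Fval f xb).Finite := Set.finite_range _
  have hdesc : ∀ᶠ t : ℝ in nhdsWithin 0 (Set.Ioi 0), ∀ v ∈ WMinSet K (Fval f xb),
      f (a v) xb - f (a v) (xb + t • s) ∈ interior K :=
    (Filter.eventually_all_finite (hfin.subset fun _ hv => hv.1)).2 fun v hv =>
      eventually_sub_mem_interior_of_fderiv hKcone
        ((hf (a v)).differentiable two_ne_zero xb) (hs v hv)
  have hnear : ∀ᶠ t : ℝ in nhdsWithin 0 (Set.Ioi 0), ‖xb + t • s - xb‖ < δ := by
    have hcont : Continuous fun t : ℝ => ‖xb + t • s - xb‖ := by fun_prop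
    exact ((hcont.tendsto 0).mono_left nhdsWithin_le_nhds).eventually
      (gt_mem_nhds (by simpa using hδ))
  obtain ⟨t, hdt, hnt⟩ := (hdesc.and hnear).exists
  refine hloc _ hnt fun y hy => ?_
  obtain ⟨w, hw, hyw⟩ := exists_mem_WMinSet_sub_mem hKconvex hKcone h0 h0K hfin hy
  have hdw := hdt w hw
  rw [(ha w hw).1] at hdw
  refine ⟨f (a w) (xb + t • s), ⟨a w, rfl⟩, _,
    add_mem_interior_of_convex_of_cone hKconvex hKcone hdw hyw, ?_⟩
  dsimp only
  abel
end
end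

section
/- Let f : ℝ^n → ℝ^m be twice continuously differentiable with ‖∇²f(x)‖ ≤ 𝒦₁ for all x ∈ ℝ^n. Then there exists 𝒦 > 0 such that for all x, s ∈ ℝ^n, | −Δ_{−K}(f(x + s) − f(x)) + Δ_{−K}(∇f(x)ᵀs + ½ sᵀ∇²f(x)s) | ≤ 𝒦 ‖s‖². -/
open Set Metric Pointwise

noncomputable section

lemma abs_orientedDist_sub_le {E : Type*} [NormedAddCommGroup E] (A : Set E) (y z : E) :
    |orientedDist A y - orientedDist A z| ≤ 2 * ‖y - z‖ := by
  have lip (B : Set E) : |infDist y B - infDist z B| ≤ ‖y - z‖ := by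
    have h := (lipschitz_infDist_pt B).dist_le_mul y z
    simpa [Real.dist_eq, dist_eq_norm] using h
  have h₁ := abs_le.1 (lip A)
  have h₂ := abs_le.1 (lip Aᶜ)
  unfold orientedDist
  exact abs_le.2 ⟨by linarith, by linarith⟩

section Taylor

variable {E F : Type*} [NormedAddCommGroup E] [NormedSpace ℝ E]
  [NormedAddCommGroup F] [NormedSpace ℝ F] {f : E → F} {C : ℝ}

lemma norm_fderiv_fderiv_le (hC : ∀ x, ‖iteratedFDeriv ℝ 2 f x‖ ≤ C) (x : E) :
    ‖fderiv ℝ (fderiv ℝ f) x‖ ≤ C := by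
  rw [← norm_iteratedFDeriv_one, norm_iteratedFDeriv_fderiv]
  exact hC x

lemma ContDiff.differentiable_fderiv_of_two (hf : ContDiff ℝ 2 f) :
    Differentiable ℝ (fderiv ℝ f) :=
  (hf.fderiv_right (m := 1) (by norm_num)).differentiable one_ne_zero

lemma norm_quadForm_le (hf : ContDiff ℝ 2 f) (hC : ∀ x, ‖iteratedFDeriv ℝ 2 f x‖ ≤ C) (x s : E) :
    ‖quadForm f x s‖ ≤ C * ‖s‖ ^ 2 := by
  have h : quadForm f x s = fderiv ℝ (fderiv ℝ f) x s s := by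
    unfold quadForm
    rw [fderiv_clm_apply (hf.differentiable_fderiv_of_two x) (differentiableAt_const s)]
    simp
  rw [h]
  calc ‖fderiv ℝ (fderiv ℝ f) x s s‖ ≤ ‖fderiv ℝ (fderiv ℝ f) x‖ * ‖s‖ * ‖s‖ :=
        ContinuousLinearMap.le_opNorm₂ _ _ _
    _ ≤ C * ‖s‖ * ‖s‖ := by gcongr; exact norm_fderiv_fderiv_le hC x
    _ = C * ‖s‖ ^ 2 := by ring

lemma norm_sub_sub_fderiv_le (hf : ContDiff ℝ 2 f) (hC : ∀ x, ‖iteratedFDeriv ℝ 2 f x‖ ≤ C)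
    (x s : E) : ‖f (x + s) - f x - fderiv ℝ f x s‖ ≤ C * ‖s‖ ^ 2 := by
  have hC₀ : 0 ≤ C := (norm_nonneg _).trans (hC x)
  have bound : ∀ y ∈ closedBall x ‖s‖, ‖fderiv ℝ f y - fderiv ℝ f x‖ ≤ C * ‖s‖ := by
    intro y hy
    refine (convex_univ.norm_image_sub_le_of_norm_fderiv_le
      (fun z _ => hf.differentiable_fderiv_of_two z)
      (fun z _ => norm_fderiv_fderiv_le hC z) (mem_univ x) (mem_univ y)).trans ?_
    gcongr
    exact mem_closedBall_iff_norm.1 hy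
  have h := (convex_closedBall x ‖s‖).norm_image_sub_le_of_norm_fderiv_le'
    (fun z _ => hf.differentiable two_ne_zero z) bound
    (mem_closedBall_self (norm_nonneg s)) (y := x + s) (by simp)
  rw [add_sub_cancel_left] at h
  linarith

end Taylor

/-- if `f` is twice continuously differentiable with uniformly bounded
Hessian, then the difference between the actual reduction and the predicted (model)
reduction, measured by the oriented distance `Δ_{−K}`, is `O(‖s‖²)` uniformly. -/
theorem orientedDist_model_error_bound
    {n m : ℕ} (K : Set (EuclideanSpace ℝ (Fin m)))
    (hKne : K.Nonempty) (hKclosed : IsClosed K) (hKconvex : Convex ℝ K)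
    (hKcone : ∀ t : ℝ, 0 ≤ t → ∀ y ∈ K, t • y ∈ K)
    (hKpointed : K ∩ -K = {0})
    (hKsolid : (interior K).Nonempty)
    (f : EuclideanSpace ℝ (Fin n) → EuclideanSpace ℝ (Fin m))
    (hf : ContDiff ℝ 2 f)
    (K₁ : ℝ) (hK₁ : ∀ x : EuclideanSpace ℝ (Fin n), ‖iteratedFDeriv ℝ 2 f x‖ ≤ K₁) :
    ∃ 𝒦 > (0 : ℝ), ∀ x s : EuclideanSpace ℝ (Fin n),
      |(-(orientedDist (-K) (f (x + s) - f x))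
          + orientedDist (-K) (fderiv ℝ f x s + (2⁻¹ : ℝ) • quadForm f x s))|
        ≤ 𝒦 * ‖s‖ ^ 2 := by
  have hK₁_nonneg : 0 ≤ K₁ := (norm_nonneg _).trans (hK₁ 0)
  refine ⟨3 * K₁ + 1, by positivity, fun x s => ?_⟩
  rw [neg_add_eq_sub, abs_sub_comm]
  refine (abs_orientedDist_sub_le _ _ _).trans ?_
  rw [← sub_sub]
  have hsub := norm_sub_le (f (x + s) - f x - fderiv ℝ f x s) ((2⁻¹ : ℝ) • quadForm f x s)
  rw [norm_smul, Real.norm_of_nonneg (by norm_num : (0 : ℝ) ≤ 2⁻¹)] at hsub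
  have htaylor := norm_sub_sub_fderiv_le hf hK₁ x s
  have hquad := norm_quadForm_le hf hK₁ x s
  nlinarith [sq_nonneg ‖s‖]
end
end

section
/- Let x_k ∈ ℝ^n be not a K-critical point for F, with Min(F(x_k), K) = WMin(F(x_k), K), suppose every component Hessian ∇²f^{i,r}(x) is positive definite for all x, i, r, and let 𝒦₁ > 0 bound all Hessian norms: ‖∇²f^i(x)‖ ≤ 𝒦₁ for all i and x. Let (a^k, s_k) attain the minimum defining θ(x_k) with trust-region radius Ω_k > 0, with models m_v(s) := ∇f^{a^k(v)}(x_k)ᵀs + ½ sᵀ∇²f^{a^k(v)}(x_k)s. Suppose β > 0 is such that for every v ∈ WMin(F(x_k), K), Δ_{−K}(m_v(0) − m_v(s_k)) ≥ −(β/2) · (Δ_{−K}(∇f^{a^k(v)}(x_k)ᵀs_k)/‖s_k‖) · min{ −Δ_{−K}(∇f^{a^k(v)}(x_k)ᵀs_k)/(‖s_k‖𝒦₁), Ω_k }. Then for every v ∈ WMin(F(x_k), K), Δ_{−K}(m_v(0) − m_v(s_k)) ≥ (β/2) · (|θ(x_k)|/‖s_k‖) · min{ |θ(x_k)|/(‖s_k‖𝒦₁),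 Ω_k }. -/
open Set Metric Pointwise

noncomputable section

variable {n m p : ℕ}

theorem orientedDist_nonpos_of_mem {E : Type*} [NormedAddCommGroup E] {A : Set E} {y : E}
    (hy : y ∈ A) : orientedDist A y ≤ 0 := by
  rw [orientedDist, infDist_zero_of_mem hy, zero_sub]
  exact neg_nonpos.mpr infDist_nonneg

@[simp]
theorem modelFn_zero {E F : Type*} [NormedAddCommGroup E] [NormedSpace ℝ E]
    [NormedAddCommGroup F] [NormedSpace ℝ F] (f : E → F) (x : E) : modelFn f x 0 = 0 := by
  simp [modelFn, quadForm]

theorem Theta_zero_nonpos {n m p : ℕ} {K : Set (EuclideanSpace ℝ (Fin m))} (hK : 0 ∈ K)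
    (f : Fin p → EuclideanSpace ℝ (Fin n) → EuclideanSpace ℝ (Fin m))
    (x : EuclideanSpace ℝ (Fin n)) (a : EuclideanSpace ℝ (Fin m) → Fin p) :
    Theta K f x a 0 ≤ 0 := by
  refine Real.sSup_nonpos ?_
  rintro r ⟨v, -, rfl⟩
  have h : orientedDist (-K) 0 ≤ 0 := orientedDist_nonpos_of_mem (by simpa using hK)
  simpa using h

theorem orientedDist_fderiv_le_Theta {n m p : ℕ} (K : Set (EuclideanSpace ℝ (Fin m)))
    (f : Fin p → EuclideanSpace ℝ (Fin n) → EuclideanSpace ℝ (Fin m))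
    (x : EuclideanSpace ℝ (Fin n)) (a : EuclideanSpace ℝ (Fin m) → Fin p)
    (s : EuclideanSpace ℝ (Fin n)) {v : EuclideanSpace ℝ (Fin m)}
    (hv : v ∈ WMinSet K (Fval f x)) :
    orientedDist (-K) (fderiv ℝ (f (a v)) x s) ≤ Theta K f x a s := by
  have hfin : (WMinSet K (Fval f x)).Finite :=
    (Set.finite_range fun i => f i x).subset fun y hy => hy.1
  refine (le_max_right _ _).trans (le_csSup ?_ ⟨v, hv, rfl⟩)
  refine ((hfin.image fun v => max (orientedDist (-K) (modelFn (f (a v)) x s))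
    (orientedDist (-K) (fderiv ℝ (f (a v)) x s))).subset ?_).bddAbove
  rintro r ⟨w, hw, rfl⟩
  exact ⟨w, hw, rfl⟩

/-- sufficient decrease of the models in terms of `|θ(x_k)|`
(Corollary `utrw_kkjx`). -/
theorem model_sufficient_decrease_theta
    {n m p : ℕ} (K : Set (EuclideanSpace ℝ (Fin m)))
    (hKne : K.Nonempty) (hKclosed : IsClosed K) (hKconvex : Convex ℝ K)
    (hKcone : ∀ t : ℝ, 0 ≤ t → ∀ y ∈ K, t • y ∈ K)
    (hKpointed : K ∩ -K = {0})
    (hKsolid : (interior K).Nonempty)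
    (f : Fin p → EuclideanSpace ℝ (Fin n) → EuclideanSpace ℝ (Fin m))
    (hf : ∀ i, ContDiff ℝ 2 (f i))
    (xk : EuclideanSpace ℝ (Fin n))
    (hMW : MinSet K (Fval f xk) = WMinSet K (Fval f xk))
    (hnotcrit : ¬ KCritical K f xk)
    (hposdef : ∀ (i : Fin p) (r : Fin m) (x s : EuclideanSpace ℝ (Fin n)), s ≠ 0 →
        0 < fderiv ℝ (fun y => fderiv ℝ (fun z => f i z r) y s) x s)
    (K₁ : ℝ) (hK₁pos : 0 < K₁)
    (hK₁ : ∀ (i : Fin p) (x : EuclideanSpace ℝ (Fin n)),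
        ‖iteratedFDeriv ℝ 2 (f i) x‖ ≤ K₁)
    (Ω : ℝ) (hΩ : 0 < Ω)
    (a : EuclideanSpace ℝ (Fin m) → Fin p) (sk : EuclideanSpace ℝ (Fin n))
    (hmin : AttainsMin K f xk Ω a sk)
    (β : ℝ) (hβpos : 0 < β)
    (hβ : ∀ v ∈ WMinSet K (Fval f xk),
        orientedDist (-K) (modelFn (f (a v)) xk 0 - modelFn (f (a v)) xk sk) ≥
          -(β / 2) * (orientedDist (-K) (fderiv ℝ (f (a v)) xk sk) / ‖sk‖) *
            min (-(orientedDist (-K) (fderiv ℝ (f (a v)) xk sk)) / (‖sk‖ * K₁)) Ω) :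
    ∀ v ∈ WMinSet K (Fval f xk),
      orientedDist (-K) (modelFn (f (a v)) xk 0 - modelFn (f (a v)) xk sk) ≥
        (β / 2) * (|Theta K f xk a sk| / ‖sk‖) *
          min (|Theta K f xk a sk| / (‖sk‖ * K₁)) Ω := by
  intro v hv
  have hK0 : (0 : EuclideanSpace ℝ (Fin m)) ∈ K :=
    (hKpointed.symm.subset (Set.mem_singleton _)).1
  have hθ : Theta K f xk a sk ≤ 0 :=
    (hmin.2.2 a 0 hmin.1 (by simpa using hΩ.le)).trans (Theta_zero_nonpos hK0 f xk a)
  have hD := orientedDist_fderiv_le_Theta K f xk a sk hv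
  refine ge_trans (hβ v hv) ?_
  rw [abs_of_nonpos hθ, neg_mul, ← mul_neg, ← neg_div]
  have hD' := neg_le_neg hD
  have hθ' := neg_nonneg.mpr hθ
  have hD0 := hθ'.trans hD'
  gcongr
end
end

section
/- Let K ⊆ ℝ^m be a nonempty closed convex cone with nonempty interior and K ≠ ℝ^m. Then Δ_{−K} is monotone with respect to the cone order: for y, z ∈ ℝ^m, if y ≼_K z then Δ_{−K}(y) ≤ Δ_{−K}(z), and if y ≺_K z then Δ_{−K}(y) < Δ_{−K}(z). -/
open Set Metric Pointwise

noncomputable section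

section OrientedDist

variable {E : Type*} [NormedAddCommGroup E] {A : Set E} {z w : E}

/-- If `A` is stable under subtracting `w`, then subtracting `w` does not increase the distance
to `A`. -/
lemma infDist_sub_le_of_forall_sub_mem (hA : A.Nonempty) (h : ∀ a ∈ A, a - w ∈ A) (z : E) :
    infDist (z - w) A ≤ infDist z A := by
  refine (le_infDist hA).2 fun a ha => ?_
  simpa using infDist_le_dist_of_mem (x := z - w) (h a ha)

lemma infDist_compl_le_of_forall_sub_mem (hA : Aᶜ.Nonempty) (h : ∀ a ∈ A, a - w ∈ A) (z : E) :
    infDist z Aᶜ ≤ infDist (z - w) Aᶜ := by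
  refine (le_infDist hA).2 fun b hb => ?_
  have hbw : b + w ∈ Aᶜ := fun hmem => hb (by simpa using h _ hmem)
  calc infDist z Aᶜ ≤ dist z (b + w) := infDist_le_dist_of_mem hbw
    _ = dist (z - w) b := by simp only [dist_eq_norm]; congr 1; abel

variable [NormedSpace ℝ E] {ε : ℝ}

/-- Outside `A` the distance to `A` strictly decreases on subtracting `w`, if `A` is stable under
subtracting every vector near `w`. -/
lemma infDist_sub_lt_of_forall_ball_sub_mem [ProperSpace E] (hA : A.Nonempty) (hAc : IsClosed A)
    (hε : 0 < ε) (h : ∀ v ∈ ball w ε, ∀ a ∈ A, a - v ∈ A) (hz : z ∉ A) :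
    infDist (z - w) A < infDist z A := by
  obtain ⟨a, ha, hza⟩ := hAc.exists_infDist_eq_dist hA z
  have hpos : 0 < ‖z - a‖ := norm_pos_iff.2 (sub_ne_zero.2 fun e => hz (e ▸ ha))
  obtain ⟨t, ht0, ht⟩ := exists_between (lt_min one_pos (div_pos hε hpos))
  obtain ⟨ht1, htε⟩ := lt_min_iff.1 ht
  have hmem : w - t • (z - a) ∈ ball w ε := by
    rw [mem_ball_iff_norm, sub_sub_cancel_left, norm_neg, norm_smul, Real.norm_of_nonneg ht0.le]
    exact (lt_div_iff₀ hpos).1 htε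
  calc infDist (z - w) A ≤ dist (z - w) (a - (w - t • (z - a))) :=
        infDist_le_dist_of_mem (h _ hmem a ha)
    _ = ‖(1 - t) • (z - a)‖ := by rw [dist_eq_norm]; congr 1; module
    _ = (1 - t) * ‖z - a‖ := by rw [norm_smul, Real.norm_of_nonneg (by linarith)]
    _ < ‖z - a‖ := by nlinarith
    _ = infDist z A := by rw [hza, dist_eq_norm]

/-- Inside `A` the distance to `Aᶜ` strictly increases on subtracting `w`, if `A` is stable under
subtracting every vector near `w`. -/
lemma infDist_compl_lt_of_forall_ball_sub_mem (hA : Aᶜ.Nonempty)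
    (hε : 0 < ε) (h : ∀ v ∈ ball w ε, ∀ a ∈ A, a - v ∈ A) (hz : z ∈ A) :
    infDist z Aᶜ < infDist (z - w) Aᶜ := by
  set r := infDist z Aᶜ with hr
  have hr0 : 0 ≤ r := infDist_nonneg
  have hrε : 0 < r + ε := by linarith
  suffices r + ε ≤ infDist (z - w) Aᶜ by linarith
  refine (le_infDist hA).2 fun x hx => not_lt.1 fun hlt => hx ?_
  set v := x - (z - w) with hv
  have hvn : ‖v‖ < r + ε := by rwa [hv, ← dist_eq_norm, dist_comm]
  have hscale : ∀ s : ℝ, 0 < s → ‖(s / (r + ε)) • v‖ < s := fun s hs => by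
    rw [norm_smul, Real.norm_of_nonneg (by positivity), div_mul_eq_mul_div, div_lt_iff₀ hrε]
    gcongr
  have hfar : z + (r / (r + ε)) • v ∈ A := by
    rcases hr0.eq_or_lt with h0 | hpos
    · simpa [← h0] using hz
    · by_contra hn
      have hle : r ≤ dist z (z + (r / (r + ε)) • v) := infDist_le_dist_of_mem hn
      rw [dist_self_add_right] at hle
      exact hle.not_gt (hscale r hpos)
  have hnear : w - (ε / (r + ε)) • v ∈ ball w ε := by
    rw [mem_ball_iff_norm, sub_sub_cancel_left, norm_neg]
    exact hscale ε hε
  have hsum : (r / (r + ε)) • v + (ε / (r + ε)) • v = v := by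
    rw [← add_smul, ← add_div, div_self hrε.ne', one_smul]
  have hx_eq : x = z + (r / (r + ε)) • v - (w - (ε / (r + ε)) • v) := by
    calc x = z - w + v := by rw [hv]; abel
      _ = z - w + ((r / (r + ε)) • v + (ε / (r + ε)) • v) := by rw [hsum]
      _ = _ := by abel
  rw [hx_eq]
  exact h _ hnear _ hfar

end OrientedDist

/-- monotonicity of the oriented distance `Δ_{−K}` with respect to the
cone order: `y ≼_K z` (i.e. `z − y ∈ K`) implies `Δ_{−K}(y) ≤ Δ_{−K}(z)`, and
`y ≺_K z` (i.e. `z − y ∈ int K`) implies `Δ_{−K}(y) < Δ_{−K}(z)`. -/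
theorem orientedDist_monotone
    {m : ℕ} (K : Set (EuclideanSpace ℝ (Fin m)))
    (hKne : K.Nonempty) (hKclosed : IsClosed K) (hKconvex : Convex ℝ K)
    (hKcone : ∀ t : ℝ, 0 ≤ t → ∀ y ∈ K, t • y ∈ K)
    (hKsolid : (interior K).Nonempty)
    (hKproper : K ≠ Set.univ) :
    ∀ y z : EuclideanSpace ℝ (Fin m),
      (z - y ∈ K → orientedDist (-K) y ≤ orientedDist (-K) z) ∧
      (z - y ∈ interior K → orientedDist (-K) y < orientedDist (-K) z) := by
  intro y z
  have hadd : ∀ a ∈ K, ∀ b ∈ K, a + b ∈ K := fun a ha b hb => by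
    have hmid := hKcone 2 zero_le_two _
      (hKconvex ha hb (by norm_num : (0 : ℝ) ≤ 1 / 2) (by norm_num : (0 : ℝ) ≤ 1 / 2) (by norm_num))
    convert hmid using 1
    module
  have hsub : ∀ v ∈ K, ∀ a ∈ -K, a - v ∈ -K := fun v hv a ha => by
    rw [Set.mem_neg, neg_sub, sub_eq_add_neg]
    exact hadd v hv _ ha
  have hne : (-K).Nonempty := hKne.neg
  have hnec : (-K)ᶜ.Nonempty := by
    obtain ⟨x, hx⟩ := (Set.ne_univ_iff_exists_notMem K).1 hKproper
    exact ⟨-x, by simpa using hx⟩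
  have hle : z - y ∈ K →
      infDist y (-K) ≤ infDist z (-K) ∧ infDist z (-K)ᶜ ≤ infDist y (-K)ᶜ := fun hw => by
    have h₁ := infDist_sub_le_of_forall_sub_mem hne (hsub _ hw) z
    have h₂ := infDist_compl_le_of_forall_sub_mem hnec (hsub _ hw) z
    rw [sub_sub_cancel] at h₁ h₂
    exact ⟨h₁, h₂⟩
  unfold orientedDist
  refine ⟨fun hw => sub_le_sub (hle hw).1 (hle hw).2, fun hw => ?_⟩
  obtain ⟨h₁, h₂⟩ := hle (interior_subset hw)
  obtain ⟨ε, hε, hball⟩ := Metric.mem_nhds_iff.1 (mem_interior_iff_mem_nhds.1 hw)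
  have hstable : ∀ v ∈ ball (z - y) ε, ∀ a ∈ -K, a - v ∈ -K := fun v hv => hsub v (hball hv)
  by_cases hz : z ∈ -K
  · have hlt := infDist_compl_lt_of_forall_ball_sub_mem hnec hε hstable hz
    rw [sub_sub_cancel] at hlt
    linarith
  · have hlt := infDist_sub_lt_of_forall_ball_sub_mem hne hKclosed.neg hε hstable hz
    rw [sub_sub_cancel] at hlt
    linarith
end
end
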